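/- arXiv:math/0307167 — 3 statements merged into one kernel-verified Lean document; each statement's English description precedes it below -/
import Mathlib

section
/- Suppose the sequence ω_r (one sequence for each T>0) is persistently exciting and there exists w_M>0 such that |ω_r(i)| ≤ w_M for all i≥0. For T>0 and (x_e,y_e)∈ℝ² define W_T(k,(x_e,y_e)) := −T·Σ_{i=k}^{∞} e^{(k−i)T}·ω_r(i)²·y_e². Then there exist strictly positive numbers T*, c₃, c₄, K₂, α̃_y such that for all T∈(0,T*), all k≥0 and all (x_e,y_e)∈ℝ²: (a) −c₃·y_e² ≤ W_T(k,(x_e,y_e)) ≤ −c₄·y_e²; and (b) [W_T(k+1,(x_e', y_e − T·ω_r(k)·x_e)) − W_T(k,(x_e,y_e))]/T ≤ ω_r(k)²·y_e² − α̃_y·y_e² + K₂·x_e² (for any x_e', since W_T does not depend on its first state component). In particular one may take c₃ = 2w_M² and c₄ = μ·e^{−L}/(1−e^{−L}), where μ,L come from the PE condition. -/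
/-- The auxiliary function `W_T(k, y_e) = −T·Σ_{i≥k} e^{(k−i)T} ω_r(i)² y_e²` (written with
`i = k + j`). It does not depend on the `x_e`-component of the state. -/
noncomputable def Wfun (wr : ℝ → ℕ → ℝ) (T : ℝ) (k : ℕ) (ye : ℝ) : ℝ :=
  -(T * ∑' j : ℕ, Real.exp (-(j : ℝ) * T) * (wr T (k + j)) ^ 2 * ye ^ 2)

/-- A window of mass at least `μ` whose terms are bounded by `B` cannot be concentrated at its
last index, so exponential weighting gains a factor `1 + T / L` over the smallest weight. -/
theorem window_sum_exp_lower_bound {a : ℕ → ℝ} {B μ L T : ℝ} {N M : ℕ}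
    (ha : ∀ j, 0 ≤ a j) (haB : ∀ j, a j ≤ B) (hμ : 0 < μ) (hL : 0 < L) (hT : 0 < T)
    (hML : 2 ≤ M * L) (hTM : 2 * T * M * B ≤ μ)
    (hsum : μ ≤ T * ∑ j ∈ Finset.range (N + 1), a j) :
    μ * (1 + T / L) * Real.exp (-(N : ℝ) * T) ≤
      T * ∑ j ∈ Finset.range (N + 1), Real.exp (-(j : ℝ) * T) * a j := by
  have hB : 0 ≤ B := (ha 0).trans (haB 0)
  rw [← Finset.sum_range_reflect] at hsum ⊢
  simp only [Nat.add_sub_cancel] at hsum ⊢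
  have hind : ∑ i ∈ Finset.range (N + 1), (if i < M then (1 : ℝ) else 0) ≤ M := by
    rw [← Finset.sum_filter, Finset.sum_const, nsmul_eq_mul, mul_one]
    have : (Finset.range (N + 1)).filter (· < M) ⊆ Finset.range M := by
      intro i hi
      simpa using (Finset.mem_filter.mp hi).2
    exact_mod_cast (Finset.card_le_card this).trans_eq (Finset.card_range M)
  have hmass : M * ∑ i ∈ Finset.range (N + 1), a (N - i) - M * B * M ≤
      ∑ i ∈ Finset.range (N + 1), (i : ℝ) * a (N - i) := by
    calc M * ∑ i ∈ Finset.range (N + 1), a (N - i) - M * B * M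
        ≤ M * ∑ i ∈ Finset.range (N + 1), a (N - i) -
            M * B * ∑ i ∈ Finset.range (N + 1), (if i < M then (1 : ℝ) else 0) := by gcongr
      _ = ∑ i ∈ Finset.range (N + 1),
            (M * a (N - i) - M * B * (if i < M then (1 : ℝ) else 0)) := by
          rw [Finset.sum_sub_distrib, Finset.mul_sum, Finset.mul_sum]
      _ ≤ _ := by
          refine Finset.sum_le_sum fun i _ => ?_
          split_ifs with h
          · have h₁ : (M : ℝ) * a (N - i) ≤ M * B := by gcongr; exact haB _
            have h₂ : 0 ≤ (i : ℝ) * a (N - i) := mul_nonneg i.cast_nonneg (ha _)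
            linarith
          · have h₁ : (M : ℝ) ≤ i := by exact_mod_cast not_lt.mp h
            have := mul_le_mul_of_nonneg_right h₁ (ha (N - i))
            linarith
  have hgain : μ / L ≤ T * ∑ i ∈ Finset.range (N + 1), (i : ℝ) * a (N - i) := by
    have h₁ := mul_le_mul_of_nonneg_left hmass hT.le
    have h₂ := mul_le_mul_of_nonneg_left hsum (Nat.cast_nonneg (α := ℝ) M)
    have h₃ := mul_le_mul_of_nonneg_left hTM (Nat.cast_nonneg (α := ℝ) M)
    have h₄ : μ / L ≤ M * μ / 2 := by
      rw [div_le_iff₀ hL]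
      nlinarith
    nlinarith
  have hterm : Real.exp (-(N : ℝ) * T) * ∑ i ∈ Finset.range (N + 1), (1 + i * T) * a (N - i) ≤
      ∑ i ∈ Finset.range (N + 1), Real.exp (-((N - i : ℕ) : ℝ) * T) * a (N - i) := by
    rw [Finset.mul_sum]
    refine Finset.sum_le_sum fun i hi => ?_
    have hiN : i ≤ N := Nat.lt_succ_iff.mp (Finset.mem_range.mp hi)
    rw [← mul_assoc]
    refine mul_le_mul_of_nonneg_right ?_ (ha _)
    rw [Nat.cast_sub hiN, show -((N : ℝ) - i) * T = -N * T + i * T by ring, Real.exp_add]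
    gcongr
    linarith [Real.add_one_le_exp ((i : ℝ) * T)]
  have hsplit : ∑ i ∈ Finset.range (N + 1), (1 + i * T) * a (N - i) =
      ∑ i ∈ Finset.range (N + 1), a (N - i) +
        T * ∑ i ∈ Finset.range (N + 1), (i : ℝ) * a (N - i) := by
    rw [Finset.mul_sum, ← Finset.sum_add_distrib]
    exact Finset.sum_congr rfl fun i _ => by ring
  calc μ * (1 + T / L) * Real.exp (-(N : ℝ) * T)
      = Real.exp (-(N : ℝ) * T) * (μ + T * (μ / L)) := by ring
    _ ≤ Real.exp (-(N : ℝ) * T) * (T * ∑ i ∈ Finset.range (N + 1), a (N - i) +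
          T * (T * ∑ i ∈ Finset.range (N + 1), (i : ℝ) * a (N - i))) := by gcongr
    _ = T * (Real.exp (-(N : ℝ) * T) *
          ∑ i ∈ Finset.range (N + 1), (1 + i * T) * a (N - i)) := by rw [hsplit]; ring
    _ ≤ _ := mul_le_mul_of_nonneg_left hterm hT.le

/-- The exponentially discounted tail sum of `a` from time `k` on, with step size `T`. -/
noncomputable def discountedTail (a : ℕ → ℝ) (T : ℝ) (k : ℕ) : ℝ :=
  ∑' j : ℕ, Real.exp (-(j : ℝ) * T) * a (k + j)

theorem Wfun_eq (wr : ℝ → ℕ → ℝ) (T : ℝ) (k : ℕ) (ye : ℝ) :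
    Wfun wr T k ye = -(T * discountedTail (fun i => wr T i ^ 2) T k) * ye ^ 2 := by
  rw [Wfun, discountedTail, tsum_mul_right]
  ring

theorem exp_neg_natCast_mul (T : ℝ) (j : ℕ) :
    Real.exp (-(j : ℝ) * T) = Real.exp (-T) ^ j := by
  rw [← Real.exp_nat_mul]
  ring_nf

theorem half_le_one_sub_exp_neg {T : ℝ} (hT : 0 ≤ T) (hT1 : T ≤ 1) :
    T / 2 ≤ 1 - Real.exp (-T) := by
  have h := Real.add_one_le_exp T
  have hmul : Real.exp (-T) * Real.exp T = 1 := by rw [← Real.exp_add]; simp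
  nlinarith [Real.exp_pos (-T)]

section

variable {a : ℕ → ℝ} {B T : ℝ}

theorem summable_discounted (ha : ∀ j, 0 ≤ a j) (haB : ∀ j, a j ≤ B) (hT : 0 < T) (k : ℕ) :
    Summable fun j : ℕ => Real.exp (-(j : ℝ) * T) * a (k + j) := by
  have hgeom : Summable fun j : ℕ => Real.exp (-T) ^ j * B :=
    (summable_geometric_of_lt_one (Real.exp_pos _).le (by simpa using hT)).mul_right B
  refine hgeom.of_nonneg_of_le (fun j => mul_nonneg (Real.exp_pos _).le (ha _)) fun j => ?_
  rw [exp_neg_natCast_mul]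
  gcongr
  exact haB _

theorem discountedTail_nonneg (ha : ∀ j, 0 ≤ a j) (k : ℕ) : 0 ≤ discountedTail a T k :=
  tsum_nonneg fun _ => mul_nonneg (Real.exp_pos _).le (ha _)

theorem mul_discountedTail_le (ha : ∀ j, 0 ≤ a j) (haB : ∀ j, a j ≤ B) (hT : 0 < T)
    (hT1 : T ≤ 1) (k : ℕ) : T * discountedTail a T k ≤ 2 * B := by
  have hB : 0 ≤ B := (ha 0).trans (haB 0)
  have hq : Real.exp (-T) < 1 := by simpa using hT
  have hle : discountedTail a T k ≤ (1 - Real.exp (-T))⁻¹ * B := by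
    rw [← tsum_geometric_of_lt_one (Real.exp_pos _).le hq, ← tsum_mul_right]
    refine (summable_discounted ha haB hT k).tsum_le_tsum (fun j => ?_)
      ((summable_geometric_of_lt_one (Real.exp_pos _).le hq).mul_right B)
    rw [exp_neg_natCast_mul]
    gcongr
    exact haB _
  have hinv : T * (1 - Real.exp (-T))⁻¹ ≤ 2 := by
    rw [← div_eq_mul_inv, div_le_iff₀ (by linarith)]
    linarith [half_le_one_sub_exp_neg hT.le hT1]
  calc T * discountedTail a T k ≤ T * ((1 - Real.exp (-T))⁻¹ * B) := by gcongr
    _ = T * (1 - Real.exp (-T))⁻¹ * B := by ring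
    _ ≤ 2 * B := by gcongr

theorem discountedTail_eq_sum_add (ha : ∀ j, 0 ≤ a j) (haB : ∀ j, a j ≤ B) (hT : 0 < T)
    (k n : ℕ) :
    discountedTail a T k = ∑ j ∈ Finset.range n, Real.exp (-(j : ℝ) * T) * a (k + j) +
      Real.exp (-(n : ℝ) * T) * discountedTail a T (k + n) := by
  rw [discountedTail, ← (summable_discounted ha haB hT k).sum_add_tsum_nat_add n,
    discountedTail, ← tsum_mul_left]
  congr 1
  refine tsum_congr fun j => ?_
  rw [← mul_assoc, ← Real.exp_add, add_assoc, add_comm n j]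
  push_cast
  ring_nf

theorem le_mul_discountedTail {μ L : ℝ} {M : ℕ} (ha : ∀ j, 0 ≤ a j) (haB : ∀ j, a j ≤ B)
    (hT : 0 < T) (hμ : 0 < μ) (hL : 0 < L) (hML : 2 ≤ M * L) (hTM : 2 * T * M * B ≤ μ)
    (hPE : ∀ j, μ ≤ T * ∑ i ∈ Finset.Icc j (j + Nat.floor (L / T)), a i) (k : ℕ) :
    μ * Real.exp (-L) / (1 - Real.exp (-L)) ≤ T * discountedTail a T k := by
  set N := Nat.floor (L / T)
  have hNL : (N : ℝ) * T ≤ L := by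
    have := Nat.floor_le (div_pos hL hT).le
    rwa [le_div_iff₀ hT] at this
  set c := ⨅ i, T * discountedTail a T i
  have hbdd : BddBelow (Set.range fun i => T * discountedTail a T i) :=
    ⟨0, by rintro _ ⟨i, rfl⟩; exact mul_nonneg hT.le (discountedTail_nonneg ha i)⟩
  have hc : ∀ i, c ≤ T * discountedTail a T i := ciInf_le hbdd
  have hc0 : 0 ≤ c := le_ciInf fun i => mul_nonneg hT.le (discountedTail_nonneg ha i)
  set q := Real.exp (-((N + 1 : ℕ) : ℝ) * T) with hq_def
  have hstep : μ * (1 + T / L) * Real.exp (-(N : ℝ) * T) + q * c ≤ c := by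
    refine le_ciInf fun i => ?_
    have hwin := window_sum_exp_lower_bound (a := fun j => a (i + j)) (N := N)
      (fun j => ha _) (fun j => haB _) hμ hL hT hML hTM (by
        have h := hPE i
        rwa [← Finset.Ico_add_one_right_eq_Icc, Finset.sum_Ico_eq_sum_range,
          show i + N + 1 - i = N + 1 by omega] at h)
    rw [discountedTail_eq_sum_add ha haB hT i (N + 1), mul_add]
    have h := mul_le_mul_of_nonneg_left (hc (i + (N + 1))) (Real.exp_pos _).le (a := q)
    linarith
  have hexpL : Real.exp (-L) ≤ Real.exp (-(N : ℝ) * T) := Real.exp_le_exp.mpr (by linarith)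
  have hq : Real.exp (-L) * (1 - T) ≤ q := by
    calc Real.exp (-L) * (1 - T) ≤ Real.exp (-L) * Real.exp (-T) := by
          gcongr
          linarith [Real.add_one_le_exp (-T)]
      _ = Real.exp (-L - T) := by rw [← Real.exp_add, sub_eq_add_neg]
      _ ≤ q := Real.exp_le_exp.mpr (by push_cast; linarith)
  have hLexp : L * Real.exp (-L) ≤ 1 - Real.exp (-L) := by
    have hmul : Real.exp (-L) * Real.exp L = 1 := by rw [← Real.exp_add]; simp
    nlinarith [Real.add_one_le_exp L, Real.exp_pos (-L)]
  have hden : 0 < 1 - Real.exp (-L) := by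
    have : 0 < L * Real.exp (-L) := by positivity
    linarith
  have hq' : 1 - q ≤ (1 - Real.exp (-L)) * (1 + T / L) := by
    have h : Real.exp (-L) * T ≤ (1 - Real.exp (-L)) * (T / L) := by
      calc Real.exp (-L) * T = L * Real.exp (-L) * (T / L) := by field_simp
        _ ≤ _ := by gcongr
    linarith
  have hfac : 0 < 1 + T / L := by positivity
  refine le_trans ?_ (hc k)
  rw [div_le_iff₀ hden]
  refine le_of_mul_le_mul_right ?_ hfac
  calc μ * Real.exp (-L) * (1 + T / L) = μ * (1 + T / L) * Real.exp (-L) := by ring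
    _ ≤ μ * (1 + T / L) * Real.exp (-(N : ℝ) * T) := by gcongr
    _ ≤ c * (1 - q) := by linarith
    _ ≤ c * ((1 - Real.exp (-L)) * (1 + T / L)) := by gcongr
    _ = c * (1 - Real.exp (-L)) * (1 + T / L) := by ring

end

/-- Claim 1: if `ω_r` is persistently exciting and bounded by `w_M`, then for
all small `T` the function `W_T` is sandwiched between `−c₃ y_e²` and `−c₄ y_e²` with
`c₃ = 2w_M²`, `c₄ = μe^{−L}/(1−e^{−L})`, and its increment along the update
`y_e ↦ y_e − T·ω_r(k)·x_e` satisfies the stated dissipation bound. -/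
theorem stmt15 (wr : ℝ → ℕ → ℝ) (wM μ L Tpe : ℝ)
    (hwM : 0 < wM) (hbound : ∀ T : ℝ, ∀ i : ℕ, |wr T i| ≤ wM)
    (hμ : 0 < μ) (hL : 0 < L) (hTpe : 0 < Tpe)
    (hPE : ∀ T : ℝ, 0 < T → T < Tpe →
      ∀ j : ℕ, μ ≤ T * ∑ k ∈ Finset.Icc j (j + Nat.floor (L / T)), (wr T k) ^ 2) :
    ∃ Tstar K₂ αy : ℝ, 0 < Tstar ∧ 0 < K₂ ∧ 0 < αy ∧
      0 < μ * Real.exp (-L) / (1 - Real.exp (-L)) ∧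
      ∀ T : ℝ, 0 < T → T < Tstar → ∀ k : ℕ, ∀ xe ye : ℝ,
        (-(2 * wM ^ 2) * ye ^ 2 ≤ Wfun wr T k ye ∧
          Wfun wr T k ye ≤ -(μ * Real.exp (-L) / (1 - Real.exp (-L))) * ye ^ 2) ∧
        (Wfun wr T (k + 1) (ye - T * wr T k * xe) - Wfun wr T k ye) / T ≤
          (wr T k) ^ 2 * ye ^ 2 - αy * ye ^ 2 + K₂ * xe ^ 2 := by
  obtain ⟨M, hM⟩ := exists_nat_ge (2 / L)
  have hML : 2 ≤ (M : ℝ) * L := (div_le_iff₀ hL).mp hM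
  have hM0 : (0 : ℝ) < M := (by positivity : 0 < 2 / L).trans_le hM
  have hden : 0 < 1 - Real.exp (-L) := by simpa using hL
  set c := μ * Real.exp (-L) / (1 - Real.exp (-L)) with hc_def
  have hc : 0 < c := by positivity
  refine ⟨min (min 1 Tpe) (μ / (2 * M * wM ^ 2)), 8 * wM ^ 4, c / 4, by positivity,
    by positivity, by positivity, hc, ?_⟩
  intro T hT hTlt k xe ye
  obtain ⟨⟨hT1, hTP⟩, hTM⟩ : (T < 1 ∧ T < Tpe) ∧ T < μ / (2 * M * wM ^ 2) := by
    simpa [lt_min_iff] using hTlt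
  have ha : ∀ j, 0 ≤ wr T j ^ 2 := fun j => sq_nonneg _
  have haB : ∀ j, wr T j ^ 2 ≤ wM ^ 2 := fun j => sq_le_sq' (neg_le_of_abs_le (hbound T j))
    (le_of_abs_le (hbound T j))
  have hTM' : 2 * T * M * wM ^ 2 ≤ μ := by
    rw [lt_div_iff₀ (by positivity)] at hTM
    linarith
  have hlow := le_mul_discountedTail ha haB hT hμ hL hML hTM' (hPE T hT hTP)
  have hup := mul_discountedTail_le ha haB hT hT1.le
  simp only [Wfun_eq]
  refine ⟨⟨?_, ?_⟩, ?_⟩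
  · exact mul_le_mul_of_nonneg_right (neg_le_neg (hup k)) (sq_nonneg ye)
  · exact mul_le_mul_of_nonneg_right (neg_le_neg (hlow k)) (sq_nonneg ye)
  have hrec := discountedTail_eq_sum_add ha haB hT k 1
  simp only [Finset.sum_range_one, Nat.cast_zero, Nat.cast_one, neg_zero, zero_mul,
    Real.exp_zero, one_mul, add_zero, neg_mul] at hrec
  rw [hrec, div_le_iff₀ hT]
  have hPc := hlow (k + 1)
  have hPB := hup (k + 1)
  rw [← hc_def] at hPc
  set S := discountedTail (fun i => wr T i ^ 2) T (k + 1)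
  set w := wr T k
  have hw : w ^ 2 ≤ wM ^ 2 := haB k
  have hP : 0 ≤ T * S := hc.le.trans hPc
  have hexp := half_le_one_sub_exp_neg hT.le hT1.le
  have hdec : T * S * (Real.exp (-T) * ye ^ 2 - (ye - T * w * xe) ^ 2) ≤
      T * S * (T * (4 * w ^ 2 * xe ^ 2 - ye ^ 2 / 4)) := by
    refine mul_le_mul_of_nonneg_left ?_ hP
    have h₁ := mul_le_mul_of_nonneg_right hexp (sq_nonneg ye)
    have h₂ : 0 ≤ T * (ye / 2 - 2 * w * xe) ^ 2 := by positivity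
    have h₃ : 0 ≤ (T * w * xe) ^ 2 := sq_nonneg _
    linarith
  have hx : T * S * (4 * w ^ 2 * xe ^ 2) ≤ 2 * wM ^ 2 * (4 * wM ^ 2 * xe ^ 2) := by gcongr
  have hy : c * (ye ^ 2 / 4) ≤ T * S * (ye ^ 2 / 4) := by gcongr
  have hxy := mul_le_mul_of_nonneg_left (sub_le_sub hx hy) hT.le
  linarith
end

section
/- Consider the zero-input x-subsystem of the Euler closed-loop unicycle model on ℝ² with state x=(x_e,y_e): x_e(k+1) = (1−T·a₂)x_e(k) + T·ω_r(k)·y_e(k) − T²·ϑ(k,x_e(k),y_e(k)), y_e(k+1) = y_e(k) − T·ω_r(k)·x_e(k). Assume ω_r is persistently exciting and there exists w_M>0 bounding |ω_r(k)| and |ω_r(k)−ω_r(k−1)|/T for all k≥0 and all small T. Then there exists a₂>0 such that for every K>0 and every ϑ with |ϑ(k,x)| ≤ K|x|, there exist strictly positive constants c₁', c₂, c̃₃, T̃ and for each T∈(0,T̃) a function U_T:ℕ×ℝ²→ℝ such that for all k≥0 and all x∈ℝ²: c₁'·|x|² ≤ U_T(k,x) ≤ c₂·|x|² and U_T(k+1,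 F_{1T}(k,x)) − U_T(k,x) ≤ −T·c̃₃·|x|², where F_{1T}(k,x) denotes the above update map; consequently the system is uniformly globally exponentially stable: there exist c,λ>0 such that |φ_T(k,k₀,x₀)| ≤ c·|x₀|·e^{−λ(k−k₀)T} for all T∈(0,T̃), k₀≥0, x₀∈ℝ² and k≥k₀. -/
/-- The weighted window sum of `f` over `N` consecutive indices starting at `k`, normalised so that
its forward difference is `T` times `f k` minus the average of `f` over the next window. -/
noncomputable def windowSum (f : ℕ → ℝ) (T : ℝ) (N k : ℕ) : ℝ :=
  T / N * ∑ i ∈ Finset.range N,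
    (∑ j ∈ Finset.range k, f j - ∑ j ∈ Finset.range (k + 1 + i), f j)

lemma windowSum_succ_sub (f : ℕ → ℝ) (T : ℝ) {N : ℕ} (hN : 0 < N) (k : ℕ) :
    windowSum f T N (k + 1) - windowSum f T N k =
      T * f k - T / N * ∑ j ∈ Finset.Ico (k + 1) (k + 1 + N), f j := by
  have hN' : (N : ℝ) ≠ 0 := by positivity
  have telescope : ∑ i ∈ Finset.range N, (∑ j ∈ Finset.range (k + 1 + (i + 1)), f j
      - ∑ j ∈ Finset.range (k + 1 + i), f j) = ∑ j ∈ Finset.Ico (k + 1) (k + 1 + N), f j := by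
    rw [Finset.sum_range_sub (fun i => ∑ j ∈ Finset.range (k + 1 + i), f j),
      Finset.sum_Ico_eq_sub _ (by omega), Nat.add_zero]
  rw [windowSum, windowSum, ← mul_sub, ← Finset.sum_sub_distrib, ← telescope]
  have hterm : ∀ i ∈ Finset.range N,
      (∑ j ∈ Finset.range (k + 1), f j - ∑ j ∈ Finset.range (k + 1 + 1 + i), f j)
        - (∑ j ∈ Finset.range k, f j - ∑ j ∈ Finset.range (k + 1 + i), f j) =
      f k - (∑ j ∈ Finset.range (k + 1 + (i + 1)), f j
        - ∑ j ∈ Finset.range (k + 1 + i), f j) := by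
    intro i _
    rw [Finset.sum_range_succ f k, show k + 1 + 1 + i = k + 1 + (i + 1) by omega]
    ring
  rw [Finset.sum_congr rfl hterm, Finset.sum_sub_distrib, Finset.sum_const, Finset.card_range,
    nsmul_eq_mul]
  field_simp

lemma abs_windowSum_le {f : ℕ → ℝ} {T B : ℝ} (hT : 0 ≤ T) (hf : ∀ j, |f j| ≤ B)
    {N : ℕ} (hN : 0 < N) (k : ℕ) : |windowSum f T N k| ≤ T * N * B := by
  have hN' : (0 : ℝ) < N := by positivity
  have hB : 0 ≤ B := (abs_nonneg _).trans (hf 0)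
  have hterm : ∀ i ∈ Finset.range N,
      |∑ j ∈ Finset.range k, f j - ∑ j ∈ Finset.range (k + 1 + i), f j| ≤ N * B := by
    intro i hi
    rw [abs_sub_comm, ← Finset.sum_Ico_eq_sub _ (by omega)]
    refine (Finset.abs_sum_le_sum_abs _ _).trans ?_
    refine (Finset.sum_le_card_nsmul _ _ B fun j _ => hf j).trans ?_
    rw [nsmul_eq_mul, Nat.card_Ico]
    have : k + 1 + i - k ≤ N := by
      have := Finset.mem_range.1 hi
      omega
    gcongr
  rw [windowSum, abs_mul, abs_of_nonneg (div_nonneg hT hN'.le)]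
  calc T / N * |∑ i ∈ Finset.range N,
        (∑ j ∈ Finset.range k, f j - ∑ j ∈ Finset.range (k + 1 + i), f j)|
      ≤ T / N * (N * (N * B)) := by
        gcongr
        refine (Finset.abs_sum_le_sum_abs _ _).trans ?_
        simpa using Finset.sum_le_card_nsmul _ _ _ hterm
    _ = T * N * B := by field_simp

/-- Under persistency of excitation there is a bounded `p` whose forward difference is at most
`T * (v k - c)`. -/
lemma exists_bounded_of_persistently_exciting {v : ℕ → ℝ} {T μ L B : ℝ} (hT : 0 < T) (hT1 : T ≤ 1)
    (hL : 0 < L) (hμ : 0 < μ) (hv : ∀ j, |v j| ≤ B)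
    (hPE : ∀ j : ℕ, μ ≤ T * ∑ k ∈ Finset.Icc j (j + Nat.floor (L / T)), v k) :
    ∃ p : ℕ → ℝ, (∀ k, |p k| ≤ (L + 1) * B) ∧
      ∀ k, p (k + 1) - p k ≤ T * (v k - μ / (L + 1)) := by
  have hB : 0 ≤ B := (abs_nonneg _).trans (hv 0)
  set N := Nat.floor (L / T) + 1 with hN
  have hN0 : 0 < N := Nat.succ_pos _
  have hNR : (0 : ℝ) < N := by positivity
  have hTN : T * N ≤ L + 1 := by
    have h1 : (Nat.floor (L / T) : ℝ) ≤ L / T := Nat.floor_le (by positivity)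
    rw [le_div_iff₀ hT] at h1
    rw [hN]
    push_cast
    linarith
  refine ⟨windowSum v T N, fun k => (abs_windowSum_le hT.le hv hN0 k).trans (by gcongr),
    fun k => ?_⟩
  rw [windowSum_succ_sub v T hN0 k]
  have hwin : Finset.Ico (k + 1) (k + 1 + N) =
      Finset.Icc (k + 1) (k + 1 + Nat.floor (L / T)) := by
    ext j
    simp only [Finset.mem_Ico, Finset.mem_Icc]
    omega
  have hsum := hPE (k + 1)
  rw [← hwin] at hsum
  have hdiv : T * (μ / (L + 1)) ≤ μ / N := by
    rw [← mul_div_assoc, div_le_div_iff₀ (by positivity) hNR]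
    nlinarith
  have havg : μ / N ≤ T / N * ∑ j ∈ Finset.Ico (k + 1) (k + 1 + N), v j := by
    rw [div_mul_eq_mul_div]
    gcongr
  linarith

/-- The remainder of second order in the step size is bounded by a multiple of `x² + y²`. -/
lemma remainder_le {M K w p T ω q θ x y : ℝ} (hM : 0 ≤ M) (hT : 0 ≤ T)
    (hT1 : T ≤ 1) (hω : |ω| ≤ w) (hq : |q| ≤ p)
    (hθ : |θ| ≤ K * Real.sqrt (x ^ 2 + y ^ 2)) :
    -2 * M * x * θ + M * ((-x + ω * y - T * θ) ^ 2 + (-ω * x) ^ 2) + ω * y * θ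
        - ω * (-x + ω * y - T * θ) * (-ω * x) + q * (-ω * x) ^ 2 ≤
      (2 * M * K + M * ((1 + w + K) ^ 2 + w ^ 2) + w * K + w * (1 + w + K) * w + p * w ^ 2)
        * (x ^ 2 + y ^ 2) := by
  set r := Real.sqrt (x ^ 2 + y ^ 2) with hr
  have hr0 : 0 ≤ r := Real.sqrt_nonneg _
  have hr2 : r ^ 2 = x ^ 2 + y ^ 2 := Real.sq_sqrt (by positivity)
  have hx : |x| ≤ r := Real.abs_le_sqrt (by nlinarith [sq_nonneg y])
  have hy : |y| ≤ r := Real.abs_le_sqrt (by nlinarith [sq_nonneg x])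
  have hw : 0 ≤ w := (abs_nonneg _).trans hω
  have hp : 0 ≤ p := (abs_nonneg _).trans hq
  have hKr : 0 ≤ K * r := (abs_nonneg _).trans hθ
  have hX : |-x + ω * y - T * θ| ≤ (1 + w + K) * r := by
    have h1 : |ω * y| ≤ w * r := by rw [abs_mul]; gcongr
    have h2 : |T * θ| ≤ K * r := by
      rw [abs_mul, abs_of_nonneg hT]
      nlinarith [abs_nonneg θ]
    calc |-x + ω * y - T * θ| ≤ |-x| + |ω * y| + |T * θ| :=
          (abs_sub _ _).trans (by gcongr; exact abs_add_le _ _)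
      _ ≤ r + w * r + K * r := by rw [abs_neg]; gcongr
      _ = (1 + w + K) * r := by ring
  have hY : |-ω * x| ≤ w * r := by rw [abs_mul, abs_neg]; gcongr
  set X := -x + ω * y - T * θ
  set Y := -ω * x
  have hXr : 0 ≤ (1 + w + K) * r := (abs_nonneg _).trans hX
  have h1 : -2 * M * x * θ ≤ 2 * M * (r * (K * r)) := by
    have : |x * θ| ≤ r * (K * r) := by rw [abs_mul]; gcongr
    have := neg_le_of_abs_le this
    nlinarith
  have h2 : X ^ 2 ≤ ((1 + w + K) * r) ^ 2 := sq_le_sq' (neg_le_of_abs_le hX) (le_of_abs_le hX)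
  have h3 : Y ^ 2 ≤ (w * r) ^ 2 := sq_le_sq' (neg_le_of_abs_le hY) (le_of_abs_le hY)
  have h4 : ω * y * θ ≤ w * r * (K * r) := by
    refine (le_abs_self _).trans ?_
    rw [abs_mul, abs_mul]
    gcongr
  have h5 : -(ω * X * Y) ≤ w * ((1 + w + K) * r) * (w * r) := by
    refine (neg_le_abs _).trans ?_
    rw [abs_mul, abs_mul]
    gcongr
  have h6 : q * Y ^ 2 ≤ p * (w * r) ^ 2 :=
    (mul_le_mul_of_nonneg_right (le_of_abs_le hq) (sq_nonneg _)).trans (by gcongr)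
  have h7 : M * (X ^ 2 + Y ^ 2) ≤ M * (((1 + w + K) * r) ^ 2 + (w * r) ^ 2) := by gcongr
  rw [← hr2]
  linarith

/-- One-step decrease of the strict Lyapunov function. -/
lemma lyapunov_step {M K w p c C T ω ω' q q' θ x y : ℝ} (hc : 0 < c) (hM : 0 ≤ M)
    (hMc : w ^ 2 + (2 * w + 2 * p * w) ^ 2 / (2 * c) + c / 2 ≤ 2 * M)
    (hC : 2 * M * K + M * ((1 + w + K) ^ 2 + w ^ 2) + w * K + w * (1 + w + K) * w + p * w ^ 2 ≤ C)
    (hT : 0 < T) (hT1 : T ≤ 1) (hTC : T * C ≤ c / 4)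
    (hω : |ω| ≤ w) (hω' : |ω - ω'| ≤ T * w) (hq' : |q'| ≤ p)
    (hqq : q' - q ≤ T * (ω ^ 2 - c)) (hθ : |θ| ≤ K * Real.sqrt (x ^ 2 + y ^ 2)) :
    (M * (((1 - T * 1) * x + T * ω * y - T ^ 2 * θ) ^ 2 + (y - T * ω * x) ^ 2)
        - ω * ((1 - T * 1) * x + T * ω * y - T ^ 2 * θ) * (y - T * ω * x)
        + q' * (y - T * ω * x) ^ 2)
      - (M * (x ^ 2 + y ^ 2) - ω' * x * y + q * y ^ 2) ≤ -(T * (c / 4) * (x ^ 2 + y ^ 2)) := by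
  have hw : 0 ≤ w := (abs_nonneg _).trans hω
  have hp : 0 ≤ p := (abs_nonneg _).trans hq'
  have hR := remainder_le hM hT.le hT1 hω hq' hθ
  set R := -2 * M * x * θ + M * ((-x + ω * y - T * θ) ^ 2 + (-ω * x) ^ 2) + ω * y * θ
        - ω * (-x + ω * y - T * θ) * (-ω * x) + q' * (-ω * x) ^ 2 with hRdef
  have hs : 0 ≤ x ^ 2 + y ^ 2 := by positivity
  have hTR : T * R ≤ c / 4 * (x ^ 2 + y ^ 2) :=
    calc T * R ≤ T * (C * (x ^ 2 + y ^ 2)) := by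
          gcongr
          exact hR.trans (by gcongr)
      _ = T * C * (x ^ 2 + y ^ 2) := by ring
      _ ≤ c / 4 * (x ^ 2 + y ^ 2) := by gcongr
  have h1 : -((ω - ω') * x * y) ≤ T * (w * |x * y|) := by
    rw [mul_assoc]
    refine (neg_le_abs _).trans ?_
    rw [abs_mul, ← mul_assoc]
    gcongr
  have h2 : (q' - q) * y ^ 2 ≤ T * (ω ^ 2 - c) * y ^ 2 := by gcongr
  have h3 : ω * (x * y) ≤ w * |x * y| := by
    refine (le_abs_self _).trans ?_
    rw [abs_mul]
    gcongr
  have h4 : -(2 * q' * ω * (x * y)) ≤ 2 * p * w * |x * y| := by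
    refine (neg_le_abs _).trans ?_
    rw [abs_mul, abs_mul, abs_mul, abs_two]
    gcongr
  have h5 : ω ^ 2 * x ^ 2 ≤ w ^ 2 * x ^ 2 :=
    mul_le_mul_of_nonneg_right (sq_le_sq' (neg_le_of_abs_le hω) (le_of_abs_le hω)) (sq_nonneg x)
  have hyoung : (2 * w + 2 * p * w) * |x * y| ≤
      (2 * w + 2 * p * w) ^ 2 / (2 * c) * x ^ 2 + c / 2 * y ^ 2 := by
    rw [abs_mul, ← sq_abs x, ← sq_abs y]
    have : (2 * w + 2 * p * w) ^ 2 / (2 * c) * |x| ^ 2 + c / 2 * |y| ^ 2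
        - (2 * w + 2 * p * w) * (|x| * |y|)
        = ((2 * w + 2 * p * w) * |x| - c * |y|) ^ 2 / (2 * c) := by
      field_simp
      ring
    have : 0 ≤ ((2 * w + 2 * p * w) * |x| - c * |y|) ^ 2 / (2 * c) := by positivity
    linarith
  have hMx := mul_le_mul_of_nonneg_right hMc (sq_nonneg x)
  have hsum : -2 * M * x ^ 2 + ω ^ 2 * x ^ 2 + ω * (x * y) + w * |x * y| - c * y ^ 2
      - 2 * q' * ω * (x * y) + T * R ≤ -(c / 4 * (x ^ 2 + y ^ 2)) := by
    linarith
  have hsumT := mul_le_mul_of_nonneg_left hsum hT.le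
  rw [hRdef] at hsumT
  linarith

/-- A sequence of nonnegative numbers admitting a Lyapunov function decays exponentially. -/
lemma sqrt_le_of_lyapunov {V r : ℕ → ℝ} {c₁ c₂ c₃ T : ℝ} {k₀ : ℕ} (h₁ : 0 < c₁) (h₂ : 0 < c₂)
    (h₃ : 0 < c₃) (hT : 0 < T) (hlow : ∀ k, k₀ ≤ k → c₁ * r k ≤ V k)
    (hup : ∀ k, k₀ ≤ k → V k ≤ c₂ * r k) (hr : ∀ k, 0 ≤ r k)
    (hdec : ∀ k, k₀ ≤ k → V (k + 1) - V k ≤ -(T * c₃ * r k)) {k : ℕ} (hk : k₀ ≤ k) :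
    Real.sqrt (r k) ≤ Real.sqrt (c₂ / c₁) * Real.sqrt (r k₀) *
      Real.exp (-(c₃ / (2 * c₂)) * ((k - k₀ : ℕ) : ℝ) * T) := by
  have hV : ∀ n, V (k₀ + n) ≤ V k₀ * Real.exp (-(c₃ / c₂) * n * T) := by
    intro n
    induction n with
    | zero => simp
    | succ n ih =>
      have hk' : k₀ ≤ k₀ + n := Nat.le_add_right _ _
      have hV0 : 0 ≤ V (k₀ + n) := (mul_nonneg h₁.le (hr _)).trans (hlow _ hk')
      have h1 : V (k₀ + n) / c₂ ≤ r (k₀ + n) := by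
        rw [div_le_iff₀' h₂]
        exact hup _ hk'
      have h2 : V (k₀ + (n + 1)) ≤ V (k₀ + n) * (-(c₃ / c₂) * T + 1) := by
        have h3 := hdec _ hk'
        have h4 : T * c₃ * (V (k₀ + n) / c₂) ≤ T * c₃ * r (k₀ + n) := by gcongr
        have h5 : T * c₃ * (V (k₀ + n) / c₂) = V (k₀ + n) * (c₃ / c₂ * T) := by ring
        rw [← Nat.add_assoc]
        linarith
      calc V (k₀ + (n + 1)) ≤ V (k₀ + n) * Real.exp (-(c₃ / c₂) * T) :=
            h2.trans (by gcongr; exact Real.add_one_le_exp _)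
        _ ≤ V k₀ * Real.exp (-(c₃ / c₂) * n * T) * Real.exp (-(c₃ / c₂) * T) := by gcongr
        _ = V k₀ * Real.exp (-(c₃ / c₂) * (n + 1 : ℕ) * T) := by
            rw [mul_assoc, ← Real.exp_add]
            push_cast
            ring_nf
  obtain ⟨n, rfl⟩ := Nat.exists_eq_add_of_le hk
  rw [Nat.add_sub_cancel_left, ← Real.sqrt_mul (by positivity)]
  refine Real.sqrt_le_iff.2 ⟨by positivity, ?_⟩
  rw [mul_pow, Real.sq_sqrt (mul_nonneg (by positivity) (hr _)), ← Real.exp_nat_mul]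
  have hexp : ((2 : ℕ) : ℝ) * (-(c₃ / (2 * c₂)) * n * T) = -(c₃ / c₂) * n * T := by
    push_cast
    field_simp
  rw [hexp, div_mul_eq_mul_div, div_mul_eq_mul_div, le_div_iff₀' h₁]
  exact (hlow _ hk).trans ((hV n).trans (by gcongr; exact hup _ le_rfl))

/-- for the zero-input `x`-subsystem of the Euler closed-loop unicycle model,
under boundedness and persistency of excitation of `ω_r`, there is a gain `a₂ > 0` such that
for every `K > 0` and every correction `ϑ` with `|ϑ(k,x)| ≤ K|x|` there is a quadratically
sandwiched, strictly decreasing Lyapunov function `U_T`; consequently the system is uniformly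
globally exponentially stable. -/
theorem stmt16 (wr : ℝ → ℤ → ℝ)
    (hbound : ∃ That wM : ℝ, 0 < That ∧ 0 < wM ∧ ∀ T : ℝ, 0 < T → T < That →
      (∀ k : ℤ, -1 ≤ k → |wr T k| ≤ wM) ∧
      (∀ k : ℤ, 0 ≤ k → |wr T k - wr T (k - 1)| / T ≤ wM))
    (hPE : ∃ μ L Tpe : ℝ, 0 < μ ∧ 0 < L ∧ 0 < Tpe ∧ ∀ T : ℝ, 0 < T → T < Tpe →
      ∀ j : ℕ, μ ≤ T * ∑ k ∈ Finset.Icc j (j + Nat.floor (L / T)), (wr T (k : ℤ)) ^ 2) :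
    ∃ a₂ : ℝ, 0 < a₂ ∧ ∀ K : ℝ, 0 < K →
      ∀ ϑ : ℕ → ℝ → ℝ → ℝ,
        (∀ k xe ye, |ϑ k xe ye| ≤ K * Real.sqrt (xe ^ 2 + ye ^ 2)) →
        ∃ c₁' c₂ c₃ Tt : ℝ, 0 < c₁' ∧ 0 < c₂ ∧ 0 < c₃ ∧ 0 < Tt ∧
          (∀ T : ℝ, 0 < T → T < Tt → ∃ U : ℕ → ℝ → ℝ → ℝ,
            ∀ k : ℕ, ∀ xe ye : ℝ,
              c₁' * (xe ^ 2 + ye ^ 2) ≤ U k xe ye ∧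
              U k xe ye ≤ c₂ * (xe ^ 2 + ye ^ 2) ∧
              U (k + 1) ((1 - T * a₂) * xe + T * wr T (k : ℤ) * ye - T ^ 2 * ϑ k xe ye)
                  (ye - T * wr T (k : ℤ) * xe) - U k xe ye ≤
                -(T * c₃ * (xe ^ 2 + ye ^ 2))) ∧
          (∃ cc lam : ℝ, 0 < cc ∧ 0 < lam ∧ ∀ T : ℝ, 0 < T → T < Tt →
            ∀ k₀ : ℕ, ∀ xe ye : ℕ → ℝ,
              (∀ k, k₀ ≤ k → xe (k + 1) =
                (1 - T * a₂) * xe k + T * wr T (k : ℤ) * ye k - T ^ 2 * ϑ k (xe k) (ye k)) →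
              (∀ k, k₀ ≤ k → ye (k + 1) = ye k - T * wr T (k : ℤ) * xe k) →
              ∀ k, k₀ ≤ k →
                Real.sqrt ((xe k) ^ 2 + (ye k) ^ 2) ≤
                  cc * Real.sqrt ((xe k₀) ^ 2 + (ye k₀) ^ 2) *
                    Real.exp (-lam * ((k - k₀ : ℕ) : ℝ) * T)) := by
  obtain ⟨That, w, hThat, hw, hbd⟩ := hbound
  obtain ⟨μ, L, Tpe, hμ, hL, hTpe, hPE⟩ := hPE
  refine ⟨1, one_pos, fun K hK ϑ hϑ => ?_⟩
  set c := μ / (L + 1) with hc_def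
  have hc : 0 < c := by positivity
  set p := (L + 1) * w ^ 2 with hp_def
  have hp : 0 < p := by positivity
  set M := w ^ 2 + (2 * w + 2 * p * w) ^ 2 / (2 * c) + c / 2 + (1 + w + p) with hM_def
  have hQ : 0 ≤ (2 * w + 2 * p * w) ^ 2 / (2 * c) := by positivity
  have hM : 0 < M := by positivity
  have hM1 : 1 + w + p ≤ M := by nlinarith [sq_nonneg w]
  have hM2 : w ^ 2 + (2 * w + 2 * p * w) ^ 2 / (2 * c) + c / 2 ≤ 2 * M := by linarith
  set C := 2 * M * K + M * ((1 + w + K) ^ 2 + w ^ 2) + w * K + w * (1 + w + K) * w + p * w ^ 2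
    with hC_def
  have hC : 0 < C := by positivity
  clear_value M C
  have hU : ∀ T : ℝ, 0 < T → T < min (min That Tpe) (min 1 (c / (4 * C))) →
      ∃ U : ℕ → ℝ → ℝ → ℝ, ∀ k : ℕ, ∀ xe ye : ℝ,
        1 * (xe ^ 2 + ye ^ 2) ≤ U k xe ye ∧
        U k xe ye ≤ (M + w + p) * (xe ^ 2 + ye ^ 2) ∧
        U (k + 1) ((1 - T * 1) * xe + T * wr T (k : ℤ) * ye - T ^ 2 * ϑ k xe ye)
            (ye - T * wr T (k : ℤ) * xe) - U k xe ye ≤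
          -(T * (c / 4) * (xe ^ 2 + ye ^ 2)) := by
    intro T hT hTlt
    simp only [lt_min_iff] at hTlt
    obtain ⟨⟨hT1, hT2⟩, hT3, hT4⟩ := hTlt
    obtain ⟨hb1, hb2⟩ := hbd T hT hT1
    have hTC : T * C ≤ c / 4 := by
      rw [lt_div_iff₀ (by positivity)] at hT4
      linarith
    obtain ⟨q, hq, hqq⟩ := exists_bounded_of_persistently_exciting
      (v := fun k => wr T (k : ℤ) ^ 2) (B := w ^ 2) hT hT3.le hL hμ
      (fun j => by
        rw [abs_pow]
        gcongr
        exact hb1 j (by omega))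
      (hPE T hT hT2)
    refine ⟨fun k x y => M * (x ^ 2 + y ^ 2) - wr T ((k : ℤ) - 1) * x * y + q k * y ^ 2,
      fun k x y => ?_⟩
    have hcross : |wr T ((k : ℤ) - 1) * x * y| ≤ w * (x ^ 2 + y ^ 2) := by
      rw [mul_assoc, abs_mul]
      have hω := hb1 ((k : ℤ) - 1) (by omega)
      have hxy : |x * y| ≤ x ^ 2 + y ^ 2 := by
        rw [abs_le]
        constructor <;> nlinarith [sq_nonneg (x + y), sq_nonneg (x - y)]
      gcongr
    have hqy : |q k * y ^ 2| ≤ p * (x ^ 2 + y ^ 2) := by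
      rw [abs_mul, abs_of_nonneg (sq_nonneg y)]
      have := hq k
      gcongr
      nlinarith [sq_nonneg x]
    have hs : 0 ≤ x ^ 2 + y ^ 2 := by positivity
    have hMs := mul_le_mul_of_nonneg_right hM1 hs
    obtain ⟨hcross1, hcross2⟩ := abs_le.1 hcross
    obtain ⟨hqy1, hqy2⟩ := abs_le.1 hqy
    refine ⟨by linarith, by linarith, ?_⟩
    have hδ := hb2 k (by omega)
    rw [div_le_iff₀' hT] at hδ
    have hstep := lyapunov_step (ω := wr T (k : ℤ)) hc hM.le hM2 hC_def.ge hT hT3.le hTC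
      (hb1 k (by omega)) hδ (hq (k + 1)) (hqq k) (hϑ k x y)
    have hcast : ((k + 1 : ℕ) : ℤ) - 1 = k := by push_cast; ring
    simpa only [hcast] using hstep
  refine ⟨1, M + w + p, c / 4, min (min That Tpe) (min 1 (c / (4 * C))), one_pos, by positivity,
    by positivity, by positivity, hU, Real.sqrt ((M + w + p) / 1), c / 4 / (2 * (M + w + p)),
    by positivity, by positivity, fun T hT hTlt k₀ xe ye hxe hye k hk => ?_⟩
  obtain ⟨U, hU⟩ := hU T hT hTlt
  refine sqrt_le_of_lyapunov (V := fun k => U k (xe k) (ye k))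
    (r := fun k => xe k ^ 2 + ye k ^ 2) one_pos (by positivity) (by positivity) hT
    (fun k _ => (hU k _ _).1) (fun k _ => (hU k _ _).2.1) (fun k => by positivity)
    (fun k hk => ?_) hk
  have := (hU k (xe k) (ye k)).2.2
  rwa [← hxe k hk, ← hye k hk] at this
end

section
/- Suppose the parameterized x-subsystem x(k+1)=f_T(k,x(k),z(k)) satisfies the Lyapunov growth assumption with data (α̃₁,α̃₂,φ,γ̃₁,γ̃₂,c,T*,V_T). Then there exist α₁,α₂ of class K∞, c'>0 and for each T∈(0,T*) a function W_T:ℕ×ℝ^{n_x}→[0,∞) such that for all x∈ℝ^{n_x}, all z∈ℝ^{n_z}, all k≥0 and all T∈(0,T*): α₁(|x|) ≤ W_T(k,x) ≤ α₂(|x|)+c' and W_T(k+1, f_T(k,x,z)) − W_T(k,x) ≤ T·μ(|z|), where μ(s) := γ̃₁(s) + γ̃₂(s)/φ(1). -/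
open Filter Topology

/-- Class `K` functions: continuous on `[0,∞)`, strictly increasing there, and zero at zero. -/
def ClassK (α : ℝ → ℝ) : Prop :=
  ContinuousOn α (Set.Ici 0) ∧ StrictMonoOn α (Set.Ici 0) ∧ α 0 = 0

/-- Class `K∞` functions: class `K` and unbounded. -/
def ClassKInfty (α : ℝ → ℝ) : Prop :=
  ClassK α ∧ ∀ M : ℝ, ∃ s : ℝ, 0 ≤ s ∧ M < α s

/-- Class `KL` functions. -/
def ClassKL (β : ℝ → ℝ → ℝ) : Prop :=
  (∀ t : ℝ, 0 < t → ClassK (fun s => β s t)) ∧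
  (∀ s : ℝ, 0 < s → AntitoneOn (fun t => β s t) (Set.Ici 0) ∧
    Filter.Tendsto (fun t => β s t) Filter.atTop (nhds 0))

/-- Class `N` functions: continuous, nondecreasing and nonnegative on `[0,∞)`. -/
def ClassN (γ : ℝ → ℝ) : Prop :=
  ContinuousOn γ (Set.Ici 0) ∧ MonotoneOn γ (Set.Ici 0) ∧ ∀ s : ℝ, 0 ≤ s → 0 ≤ γ s

/-- Euclidean norm of the joint state `(x, z)`. -/
noncomputable def jnorm {E F : Type*} [NormedAddCommGroup E] [NormedAddCommGroup F]
    (x : E) (z : F) : ℝ :=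
  Real.sqrt (‖x‖ ^ 2 + ‖z‖ ^ 2)

/-- Composition of class `K∞` functions is of class `K∞`. -/
theorem ClassKInfty.comp {g h : ℝ → ℝ} (hg : ClassKInfty g) (hh : ClassKInfty h) :
    ClassKInfty (fun s => g (h s)) := by
  obtain ⟨⟨gc, gm, g0⟩, gu⟩ := hg
  obtain ⟨⟨hc, hm, h0⟩, hu⟩ := hh
  have maps : Set.MapsTo h (Set.Ici 0) (Set.Ici 0) := fun s hs => by
    have := hm.monotoneOn Set.self_mem_Ici hs hs
    rwa [h0] at this
  refine ⟨⟨gc.comp hc maps, gm.comp hm maps, by simp [h0, g0]⟩, fun M => ?_⟩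
  obtain ⟨t, ht, hMt⟩ := gu M
  obtain ⟨s, hs, hts⟩ := hu t
  exact ⟨s, hs, hMt.trans (gm ht (maps hs) hts)⟩

/-- A class `K∞` function frozen below `1` has a continuous, positive, antitone reciprocal. -/
theorem ClassKInfty.one_div_max_one {φ : ℝ → ℝ} (hφ : ClassKInfty φ) :
    (Continuous fun s => 1 / φ (max s 1)) ∧ (∀ s, 0 < 1 / φ (max s 1)) ∧
      Antitone fun s => 1 / φ (max s 1) := by
  obtain ⟨⟨hc, hm, h0⟩, -⟩ := hφ
  have mem : ∀ s : ℝ, max s 1 ∈ Set.Ici (0 : ℝ) := fun s =>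
    zero_le_one.trans (le_max_right s 1)
  have pos : ∀ s, 0 < φ (max s 1) := fun s => by
    have := hm Set.self_mem_Ici (mem s) (zero_lt_one.trans_le (le_max_right s 1))
    rwa [h0] at this
  refine ⟨continuous_const.div (hc.comp_continuous (by fun_prop) mem) fun s => (pos s).ne',
    fun s => one_div_pos.2 (pos s), fun s t hst => ?_⟩
  exact one_div_le_one_div_of_le (pos s)
    (hm.monotoneOn (mem s) (mem t) (max_le_max_right 1 hst))

/-- The increment of a primitive of an antitone function is at most the slope at the left
endpoint times the length. -/
theorem Antitone.intervalIntegral_le_mul {q : ℝ → ℝ} (hq : Antitone q) {a b : ℝ} (hab : a ≤ b) :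
    ∫ s in a..b, q s ≤ (b - a) * q a := by
  have := intervalIntegral.integral_mono_on (μ := MeasureTheory.volume) hab hq.intervalIntegrable
    (intervalIntegrable_const (c := q a)) fun s hs => hq hs.1
  simpa using this

/-- A primitive of an antitone function is subadditive on `[0,∞)`. -/
theorem Antitone.intervalIntegral_add_le {q : ℝ → ℝ} (hq : Antitone q) {a b : ℝ}
    (ha : 0 ≤ a) (hb : 0 ≤ b) :
    ∫ s in (0 : ℝ)..(a + b), q s ≤ (∫ s in (0 : ℝ)..a, q s) + ∫ s in (0 : ℝ)..b, q s := by
  rw [← intervalIntegral.integral_add_adjacent_intervals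
    (hq.intervalIntegrable (μ := MeasureTheory.volume) (a := 0) (b := a)) hq.intervalIntegrable]
  have shift : ∫ s in a..(a + b), q s = ∫ s in (0 : ℝ)..b, q (s + a) := by
    rw [intervalIntegral.integral_comp_add_right, zero_add, add_comm b a]
  rw [shift]
  gcongr
  refine intervalIntegral.integral_mono_on hb ?_ hq.intervalIntegrable
    fun s _ => hq (by linarith)
  exact Antitone.intervalIntegrable fun s t hst => hq (by linarith)

/-- A primitive of a positive function is strictly increasing. -/
theorem strictMono_intervalIntegral_of_pos {q : ℝ → ℝ} (hq : Continuous q) (pos : ∀ s, 0 < q s) :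
    StrictMono fun v => ∫ s in (0 : ℝ)..v, q s := by
  intro a b hab
  have := intervalIntegral.intervalIntegral_pos_of_pos (hq.intervalIntegrable a b) pos hab
  have := intervalIntegral.integral_add_adjacent_intervals
    (μ := MeasureTheory.volume) (hq.intervalIntegrable 0 a) (hq.intervalIntegrable a b)
  simp only
  linarith

/-- If `1 / φ` has infinite integral at infinity, then the primitive of `1 / φ (max s 1)` is of
class `K∞`. -/
theorem ClassKInfty.integral_one_div {φ : ℝ → ℝ} (hφ : ClassKInfty φ)
    (hint : ∫⁻ s in Set.Ici (1 : ℝ), ENNReal.ofReal (1 / φ s) = ⊤) :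
    ClassKInfty fun v => ∫ s in (0 : ℝ)..v, 1 / φ (max s 1) := by
  obtain ⟨qc, qpos, -⟩ := hφ.one_div_max_one
  have sm := strictMono_intervalIntegral_of_pos qc qpos
  refine ⟨⟨?_, sm.strictMonoOn _, by simp⟩, ?_⟩
  · exact (intervalIntegral.continuous_primitive
      (fun a b => qc.intervalIntegrable a b) 0).continuousOn
  · by_contra! hbdd
    obtain ⟨M, hM⟩ := hbdd
    have integrable : MeasureTheory.IntegrableOn (fun s => 1 / φ (max s 1)) (Set.Ioi 0) := by
      refine MeasureTheory.integrableOn_Ioi_of_intervalIntegral_norm_bounded (l := atTop)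
        (b := id) M 0 (fun i => (qc.integrableOn_Icc).mono_set Set.Ioc_subset_Icc_self)
        tendsto_id ?_
      filter_upwards [eventually_ge_atTop 0] with v hv
      simpa only [Real.norm_of_nonneg (qpos _).le, id] using hM v hv
    have finite := (integrable.mono_set
      (Set.Ici_subset_Ioi.2 zero_lt_one)).lintegral_lt_top
    rw [MeasureTheory.setLIntegral_congr_fun (g := fun s => ENNReal.ofReal (1 / φ s))
      measurableSet_Ici fun s hs => by simp only [max_eq_left (Set.mem_Ici.1 hs)], hint] at finite
    exact lt_irrefl _ finite

/-- from the Lyapunov growth assumption (Assumption 2 of the paper) one builds,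
for each `T∈(0,T*)`, a function `W_T` with class-`K∞` bounds (up to an additive constant) whose
increment along `f_T` is bounded by `T·μ(|z|)` with `μ(s) = γ̃₁(s) + γ̃₂(s)/φ(1)`. -/
theorem stmt17 (nx nz : ℕ)
    (f : ℝ → ℕ → EuclideanSpace ℝ (Fin nx) → EuclideanSpace ℝ (Fin nz) →
      EuclideanSpace ℝ (Fin nx))
    (αt₁ αt₂ φ γt₁ γt₂ : ℝ → ℝ) (c Tstar : ℝ)
    (V : ℝ → ℕ → EuclideanSpace ℝ (Fin nx) → ℝ)
    (hα₁ : ClassKInfty αt₁) (hα₂ : ClassKInfty αt₂) (hφ : ClassKInfty φ)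
    (hγ₁ : ClassN γt₁) (hγ₂ : ClassN γt₂) (hc : 0 < c) (hT : 0 < Tstar)
    (hV : ∀ T : ℝ, 0 < T → T < Tstar → ∀ k : ℕ, ∀ x, ∀ z,
      (0 ≤ V T k x) ∧
      (αt₁ ‖x‖ ≤ V T k x ∧ V T k x ≤ αt₂ ‖x‖ + c) ∧
      (V T (k + 1) (f T k x z) - V T (k + 1) (f T k x 0) ≤
        T * γt₁ ‖z‖ * φ (V T k x) + T * γt₂ ‖z‖) ∧
      (V T (k + 1) (f T k x 0) - V T k x ≤ 0))
    (hint : ∫⁻ s in Set.Ici (1 : ℝ), ENNReal.ofReal (1 / φ s) = ⊤) :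
    ∃ α₁ α₂ : ℝ → ℝ, ∃ c' : ℝ, ClassKInfty α₁ ∧ ClassKInfty α₂ ∧ 0 < c' ∧
      ∀ T : ℝ, 0 < T → T < Tstar →
        ∃ W : ℕ → EuclideanSpace ℝ (Fin nx) → ℝ,
          ∀ k : ℕ, ∀ x, ∀ z,
            0 ≤ W k x ∧ α₁ ‖x‖ ≤ W k x ∧ W k x ≤ α₂ ‖x‖ + c' ∧
            W (k + 1) (f T k x z) - W k x ≤ T * (γt₁ ‖z‖ + γt₂ ‖z‖ / φ 1) := by
  obtain ⟨qc, qpos, qanti⟩ := hφ.one_div_max_one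
  have R_class := hφ.integral_one_div hint
  have sm := strictMono_intervalIntegral_of_pos qc qpos
  have add_le : ∀ a b : ℝ, 0 ≤ a → 0 ≤ b → _ := fun a b ha hb =>
    qanti.intervalIntegral_add_le ha hb
  have incr : ∀ a b : ℝ, a ≤ b → _ := fun a b hab => qanti.intervalIntegral_le_mul hab
  have adj : ∀ a b : ℝ, _ := fun a b => intervalIntegral.integral_add_adjacent_intervals
    (μ := MeasureTheory.volume) (qc.intervalIntegrable 0 a) (qc.intervalIntegrable a b)
  set R : ℝ → ℝ := fun v => ∫ s in (0 : ℝ)..v, 1 / φ (max s 1)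
  have R_zero : R 0 = 0 := R_class.1.2.2
  have αt₂_nonneg : ∀ s : ℝ, 0 ≤ s → 0 ≤ αt₂ s := fun s hs => by
    have := hα₂.1.2.1.monotoneOn Set.self_mem_Ici hs hs
    rwa [hα₂.1.2.2] at this
  refine ⟨fun s => R (αt₁ s), fun s => R (αt₂ s), R c, R_class.comp hα₁, R_class.comp hα₂,
    R_zero ▸ sm hc, fun T hT0 hT1 => ⟨fun k x => R (V T k x), fun k x z => ?_⟩⟩
  obtain ⟨V_nonneg, ⟨V_lower, V_upper⟩, V_input, V_free⟩ := hV T hT0 hT1 k x z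
  have γ₁_nonneg := hγ₁.2.2 ‖z‖ (norm_nonneg z)
  have γ₂_nonneg := hγ₂.2.2 ‖z‖ (norm_nonneg z)
  have φ_one : 0 < φ 1 := by simpa using qpos 1
  refine ⟨R_zero ▸ sm.monotone V_nonneg, sm.monotone V_lower,
    (sm.monotone V_upper).trans (add_le _ _ (αt₂_nonneg _ (norm_nonneg x)) hc.le), ?_⟩
  dsimp only
  generalize V T (k + 1) (f T k x z) = w at *
  generalize V T k x = v at *
  rcases le_total w v with hwv | hvw
  · have : 0 ≤ T * (γt₁ ‖z‖ + γt₂ ‖z‖ / φ 1) := by positivity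
    linarith [sm.monotone hwv]
  · have φ_pos : 0 < φ (max v 1) := one_div_pos.1 (qpos v)
    have φ_le : φ v ≤ φ (max v 1) := hφ.1.2.1.monotoneOn V_nonneg
      (V_nonneg.trans (le_max_left v 1)) (le_max_left v 1)
    have one_le : φ 1 ≤ φ (max v 1) := hφ.1.2.1.monotoneOn (Set.mem_Ici.2 zero_le_one)
      (V_nonneg.trans (le_max_left v 1)) (le_max_right v 1)
    calc R w - R v ≤ (w - v) * (1 / φ (max v 1)) := by
          linarith [incr v w hvw, adj v w]
      _ ≤ (T * γt₁ ‖z‖ * φ (max v 1) + T * γt₂ ‖z‖) * (1 / φ (max v 1)) := by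
          gcongr
          have : T * γt₁ ‖z‖ * φ v ≤ T * γt₁ ‖z‖ * φ (max v 1) := by gcongr
          linarith
      _ = T * (γt₁ ‖z‖ + γt₂ ‖z‖ / φ (max v 1)) := by field_simp
      _ ≤ T * (γt₁ ‖z‖ + γt₂ ‖z‖ / φ 1) := by gcongr
end
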